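/- There exists ε₀ > 0 such that for every ε ∈ (0, ε₀), the initial value ξ₀ = (g/4)·ln(m) + ε is not of type 1. Consequently ξ₀* := inf{ r ∈ ℝ : every ξ₀ > r is of type 1 } satisfies ξ₀* > (g/4)·ln(m). -/

import Mathlib

/-- The constant `m = m₁ + m₂ + 2/g`. -/
noncomputable def mconst (g m₁ m₂ : ℕ) : ℝ := (m₁ : ℝ) + (m₂ : ℝ) + 2 / (g : ℝ)

/-- The angle `θ* = arctan √(m₁/m₂)`. -/
noncomputable def thetaStar (m₁ m₂ : ℕ) : ℝ :=
  Real.arctan (Real.sqrt ((m₁ : ℝ) / (m₂ : ℝ)))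

/-- `l(θ) = m₁ cos² θ - m₂ sin² θ`. -/
noncomputable def lfun (m₁ m₂ : ℕ) (θ : ℝ) : ℝ :=
  (m₁ : ℝ) * Real.cos θ ^ 2 - (m₂ : ℝ) * Real.sin θ ^ 2

/-- `(ξ, θ, α)` is a (globally defined) solution of the ODE system (*):
`ξ' = cos α · sin 2θ`, `θ' = sin α · sin 2θ`,
`α' = sin α · sin 2θ · (exp((4/g)ξ) - m) + 2 cos α · l(θ)`. -/
def IsSolution (g m₁ m₂ : ℕ) (ξ θ α : ℝ → ℝ) : Prop :=
  ∀ t : ℝ,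
    HasDerivAt ξ (Real.cos (α t) * Real.sin (2 * θ t)) t ∧
    HasDerivAt θ (Real.sin (α t) * Real.sin (2 * θ t)) t ∧
    HasDerivAt α
      (Real.sin (α t) * Real.sin (2 * θ t) *
          (Real.exp (4 / (g : ℝ) * ξ t) - mconst g m₁ m₂) +
        2 * Real.cos (α t) * lfun m₁ m₂ (θ t)) t

/-- `Ξ Θ A` is the family of solutions of (*) indexed by the initial value `ξ₀`,
with initial condition `(ξ, θ, α)(0) = (ξ₀, θ*, π/2)`. -/
def IsShootingFamily (g m₁ m₂ : ℕ) (Ξ Θ A : ℝ → ℝ → ℝ) : Prop :=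
  ∀ ξ₀ : ℝ, IsSolution g m₁ m₂ (Ξ ξ₀) (Θ ξ₀) (A ξ₀) ∧
    Ξ ξ₀ 0 = ξ₀ ∧ Θ ξ₀ 0 = thetaStar m₁ m₂ ∧ A ξ₀ 0 = Real.pi / 2

/-- `ξ₀` is of type 1: there is `T > 0` with `θ_{ξ₀}(T) = θ*` and
`ξ'_{ξ₀}(t) ≠ 0` for all `t ∈ (0, T)`. -/
def Type1 (m₁ m₂ : ℕ) (Ξ Θ A : ℝ → ℝ → ℝ) (ξ₀ : ℝ) : Prop :=
  ∃ T > (0 : ℝ), Θ ξ₀ T = thetaStar m₁ m₂ ∧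
    ∀ t ∈ Set.Ioo (0 : ℝ) T, Real.cos (A ξ₀ t) * Real.sin (2 * Θ ξ₀ t) ≠ 0

open Real Set

/-- A continuous function that is above the level `y` at `a` and not above it at `b` has a
first time at which it reaches `y`. -/
lemma exists_first_hit {f : ℝ → ℝ} (hf : Continuous f) {a b y : ℝ} (hab : a ≤ b)
    (ha : y < f a) (hb : f b ≤ y) :
    ∃ d ∈ Ioc a b, f d = y ∧ ∀ t ∈ Ico a d, y < f t := by
  have hclosed : IsClosed {t | t ∈ Icc a b ∧ f t ≤ y} :=
    isClosed_Icc.inter (isClosed_le hf continuous_const)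
  have hbdd : BddBelow {t | t ∈ Icc a b ∧ f t ≤ y} := ⟨a, fun t ht => ht.1.1⟩
  have hmem := hclosed.csInf_mem ⟨b, ⟨hab, le_rfl⟩, hb⟩ hbdd
  set d := sInf {t | t ∈ Icc a b ∧ f t ≤ y}
  have hbelow : ∀ t ∈ Ico a d, y < f t := fun t ht => by
    by_contra! h
    exact absurd (csInf_le hbdd ⟨⟨ht.1, ht.2.le.trans hmem.1.2⟩, h⟩) (not_le.2 ht.2)
  have had : a < d := lt_of_le_of_ne hmem.1.1 fun h => by
    have := hmem.2
    rw [← h] at this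
    linarith
  refine ⟨d, ⟨had, hmem.1.2⟩, le_antisymm hmem.2 ?_, hbelow⟩
  obtain ⟨t, ht, hty⟩ := intermediate_value_Icc' had.le hf.continuousOn ⟨hmem.2, ha.le⟩
  rcases ht.2.lt_or_eq with h | h
  · exact absurd hty (hbelow t ⟨ht.1, h⟩).ne'
  · rw [← h, hty]

/-- A continuous function descending from the level `z` to a lower level `y` has a passage from
`z` to `y` during which it stays between the two levels. -/
lemma exists_descending_passage {f : ℝ → ℝ} (hf : Continuous f) {a b y z : ℝ} (hab : a ≤ b)
    (hyz : y < z) (ha : z ≤ f a) (hb : f b ≤ y) :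
    ∃ c d, a ≤ c ∧ c ≤ d ∧ d ≤ b ∧ f c = z ∧ f d = y ∧ ∀ t ∈ Icc c d, f t ∈ Icc y z := by
  obtain ⟨d, hd, hfd, hd'⟩ := exists_first_hit hf hab (hyz.trans_le ha) hb
  obtain ⟨e, he, hfe, he'⟩ := exists_first_hit (f := fun t => -f (-t)) (by fun_prop)
    (a := -d) (b := -a) (y := -z) (by linarith [hd.1]) (by simp [hfd, hyz]) (by simpa using ha)
  refine ⟨-e, d, by linarith [he.2], by linarith [he.1], hd.2, by linarith, hfd, fun t ht => ?_⟩
  constructor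
  · rcases ht.2.lt_or_eq with h | h
    · exact (hd' t ⟨by linarith [he.2, ht.1], h⟩).le
    · rw [h, hfd]
  · rcases ht.1.lt_or_eq with h | h
    · have := he' (-t) ⟨by linarith [ht.2], by linarith⟩
      simp only [neg_neg] at this
      linarith
    · rw [← h]
      linarith

lemma sub_le_sub_of_hasDerivAt_le {f h f' h' : ℝ → ℝ} {a b : ℝ} (hab : a ≤ b)
    (hf : ∀ t ∈ Icc a b, HasDerivAt f (f' t) t) (hh : ∀ t ∈ Icc a b, HasDerivAt h (h' t) t)
    (hle : ∀ t ∈ Ioo a b, f' t ≤ h' t) : f b - f a ≤ h b - h a := by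
  have hd : ∀ t ∈ Icc a b, HasDerivAt (fun t => h t - f t) (h' t - f' t) t := fun t ht =>
    (hh t ht).sub (hf t ht)
  have hmono : MonotoneOn (fun t => h t - f t) (Icc a b) := by
    refine monotoneOn_of_hasDerivWithinAt_nonneg (f' := fun t => h' t - f' t) (convex_Icc a b)
      (fun t ht => (hd t ht).continuousAt.continuousWithinAt)
      (fun t ht => (hd t (interior_subset ht)).hasDerivWithinAt) fun t ht => ?_
    rw [interior_Icc] at ht
    linarith [hle t ht]
  have := hmono (left_mem_Icc.2 hab) (right_mem_Icc.2 hab) hab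
  simp only at this
  linarith

lemma exists_log_cos_drop {φ : ℝ} (hφ : φ ∈ Ioo 0 (π / 2)) {K : ℝ} (hK : 0 < K) :
    ∃ ψ ∈ Ioo φ (π / 2), K ≤ log (cos φ) - log (cos ψ) := by
  have hc : 0 < cos φ := cos_pos_of_mem_Ioo ⟨by linarith [hφ.1, pi_pos], hφ.2⟩
  have he : 0 < exp (-K) := exp_pos _
  have he1 : exp (-K) < 1 := exp_lt_one_iff.2 (neg_neg_of_pos hK)
  have hlt : cos φ * exp (-K) < cos φ := by nlinarith
  have hle : cos φ * exp (-K) ≤ 1 := hlt.le.trans (cos_le_one φ)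
  have hpos : 0 < cos φ * exp (-K) := by positivity
  refine ⟨arccos (cos φ * exp (-K)), ⟨?_, arccos_lt_pi_div_two.2 hpos⟩, ?_⟩
  · have := arccos_lt_arccos (by linarith) hlt (cos_le_one φ)
    rwa [arccos_cos hφ.1.le (by linarith [hφ.2, pi_pos])] at this
  · rw [cos_arccos (by linarith) hle, log_mul hc.ne' he.ne', log_exp]
    linarith

/-- The weight `sin^p θ · cos^r θ` whose logarithmic derivative is `2 l(θ) / sin 2θ`. -/
noncomputable def angleWeight (p r : ℕ) (θ : ℝ) : ℝ := sin θ ^ p * cos θ ^ r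

section angleWeight

variable {p r : ℕ} {θ : ℝ}

lemma angleWeight_pos (hθ : θ ∈ Ioo 0 (π / 2)) : 0 < angleWeight p r θ :=
  mul_pos (pow_pos (sin_pos_of_mem_Ioo ⟨hθ.1, by linarith [hθ.2, pi_pos]⟩) p)
    (pow_pos (cos_pos_of_mem_Ioo ⟨by linarith [hθ.1, pi_pos], hθ.2⟩) r)

lemma angleWeight_le_cos (hr : 0 < r) (hθ : θ ∈ Ioo 0 (π / 2)) :
    angleWeight p r θ ≤ cos θ := by
  have hs := sin_pos_of_mem_Ioo (x := θ) ⟨hθ.1, by linarith [hθ.2, pi_pos]⟩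
  have hc := cos_pos_of_mem_Ioo (x := θ) ⟨by linarith [hθ.1, pi_pos], hθ.2⟩
  calc sin θ ^ p * cos θ ^ r ≤ 1 * cos θ :=
        mul_le_mul (pow_le_one₀ hs.le (sin_le_one θ))
          (pow_le_of_le_one hc.le (cos_le_one θ) hr.ne') (by positivity) zero_le_one
    _ = cos θ := one_mul _

lemma le_angleWeight {φ ψ : ℝ} (hφ : 0 < φ) (hψ : ψ < π / 2) (hθ : θ ∈ Icc φ ψ) :
    sin φ ^ p * cos ψ ^ r ≤ angleWeight p r θ := by
  have hφψ := hθ.1.trans hθ.2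
  have hs : 0 < sin φ := sin_pos_of_mem_Ioo ⟨hφ, by linarith [pi_pos]⟩
  have hc : 0 < cos ψ := cos_pos_of_mem_Ioo ⟨by linarith [pi_pos], hψ⟩
  refine mul_le_mul (pow_le_pow_left₀ hs.le ?_ p) (pow_le_pow_left₀ hc.le ?_ r)
    (by positivity) (pow_nonneg ?_ p)
  · exact sin_le_sin_of_le_of_le_pi_div_two (by linarith) (by linarith [hθ.2]) hθ.1
  · exact cos_le_cos_of_nonneg_of_le_pi (by linarith [hθ.1]) (by linarith [pi_pos]) hθ.2
  · exact (sin_pos_of_mem_Ioo ⟨by linarith [hθ.1], by linarith [hθ.2, pi_pos]⟩).le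

end angleWeight

lemma sin_two_mul_pos {θ : ℝ} (hθ : θ ∈ Ioo 0 (π / 2)) : 0 < sin (2 * θ) :=
  sin_pos_of_mem_Ioo ⟨by linarith [hθ.1], by linarith [hθ.2]⟩

/-- The coefficient `exp((4/g) x) - m` of (*), which vanishes at the critical value
`x = (g/4) log m`. -/
noncomputable def excess (g m₁ m₂ : ℕ) (x : ℝ) : ℝ := exp (4 / (g : ℝ) * x) - mconst g m₁ m₂

section excess

variable {g m₁ m₂ : ℕ}

lemma mconst_pos (hm₁ : 0 < m₁) : 0 < mconst g m₁ m₂ := by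
  have : (0 : ℝ) < m₁ := Nat.cast_pos.2 hm₁
  unfold mconst
  positivity

lemma excess_mono : Monotone (excess g m₁ m₂) := fun x y hxy =>
  sub_le_sub_right (exp_le_exp.2 (mul_le_mul_of_nonneg_left hxy (by positivity))) _

lemma excess_critical_add (hg : 0 < g) (hm₁ : 0 < m₁) (x : ℝ) :
    excess g m₁ m₂ ((g : ℝ) / 4 * log (mconst g m₁ m₂) + x) =
      mconst g m₁ m₂ * (exp (4 / (g : ℝ) * x) - 1) := by
  have hg' : (g : ℝ) ≠ 0 := (Nat.cast_pos.2 hg).ne'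
  have : 4 / (g : ℝ) * ((g : ℝ) / 4 * log (mconst g m₁ m₂) + x) =
      log (mconst g m₁ m₂) + 4 / (g : ℝ) * x := by
    field_simp
  rw [excess, this, exp_add, exp_log (mconst_pos hm₁)]
  ring

lemma excess_nonpos (hg : 0 < g) (hm₁ : 0 < m₁) {x : ℝ}
    (hx : x ≤ (g : ℝ) / 4 * log (mconst g m₁ m₂)) : excess g m₁ m₂ x ≤ 0 := by
  have := excess_critical_add (m₂ := m₂) hg hm₁ 0
  rw [add_zero, mul_zero, exp_zero, sub_self, mul_zero] at this
  exact this ▸ excess_mono hx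

lemma excess_nonneg (hg : 0 < g) (hm₁ : 0 < m₁) {x : ℝ}
    (hx : (g : ℝ) / 4 * log (mconst g m₁ m₂) ≤ x) : 0 ≤ excess g m₁ m₂ x := by
  have := excess_critical_add (m₂ := m₂) hg hm₁ 0
  rw [add_zero, mul_zero, exp_zero, sub_self, mul_zero] at this
  exact this ▸ excess_mono hx

end excess

/-- The quantity `-W(θ) cos α`; along a solution its derivative is
`W(θ) sin 2θ sin² α (exp((4/g) ξ) - m)`. -/
noncomputable def flux (m₁ m₂ : ℕ) (θ α : ℝ → ℝ) (t : ℝ) : ℝ :=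
  -(angleWeight m₁ m₂ (θ t) * cos (α t))

namespace IsSolution

variable {g m₁ m₂ : ℕ} {ξ θ α : ℝ → ℝ}

lemma continuous_theta (h : IsSolution g m₁ m₂ ξ θ α) : Continuous θ :=
  continuous_iff_continuousAt.2 fun t => (h t).2.1.continuousAt

lemma continuous_alpha (h : IsSolution g m₁ m₂ ξ θ α) : Continuous α :=
  continuous_iff_continuousAt.2 fun t => (h t).2.2.continuousAt

lemma hasDerivAt_flux (h : IsSolution g m₁ m₂ ξ θ α) (hm₁ : 0 < m₁) (hm₂ : 0 < m₂) (t : ℝ) :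
    HasDerivAt (flux m₁ m₂ θ α)
      (angleWeight m₁ m₂ (θ t) * sin (2 * θ t) * sin (α t) ^ 2 *
        excess g m₁ m₂ (ξ t)) t := by
  obtain ⟨a, rfl⟩ := Nat.exists_eq_succ_of_ne_zero hm₁.ne'
  obtain ⟨b, rfl⟩ := Nat.exists_eq_succ_of_ne_zero hm₂.ne'
  obtain ⟨-, hθ, hα⟩ := h t
  have hW := (hθ.sin.fun_pow (a + 1)).fun_mul (hθ.cos.fun_pow (b + 1))
  refine (hW.fun_mul hα.cos).fun_neg.congr_deriv ?_
  simp only [angleWeight, lfun, excess, sin_two_mul, Nat.succ_eq_add_one, Nat.add_sub_cancel]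
  push_cast
  ring

end IsSolution

/-- An arc of a solution on `[0, T]` which starts vertically, stays in the strip `0 < θ < π/2`,
and along which `ξ` decreases. -/
structure IsDescendingArc (g m₁ m₂ : ℕ) (ξ θ α : ℝ → ℝ) (T : ℝ) : Prop where
  sol : IsSolution g m₁ m₂ ξ θ α
  pos : 0 < T
  alpha_zero : α 0 = π / 2
  theta_mem : ∀ t ∈ Icc 0 T, θ t ∈ Ioo 0 (π / 2)
  cos_neg : ∀ t ∈ Ioo 0 T, cos (α t) < 0

lemma Continuous.pos_or_neg_of_ne_zero {f : ℝ → ℝ} (hf : Continuous f) {s : Set ℝ}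
    (hs : s.OrdConnected) (h0 : ∀ t ∈ s, f t ≠ 0) :
    (∀ t ∈ s, 0 < f t) ∨ ∀ t ∈ s, f t < 0 := by
  by_contra! hcon
  obtain ⟨⟨a, ha, hfa⟩, b, hb, hfb⟩ := hcon
  obtain ⟨c, hc, hfc⟩ := intermediate_value_uIcc (hf.continuousOn (s := uIcc a b))
    (mem_uIcc.2 (Or.inl ⟨hfa, hfb⟩))
  exact h0 c (hs.uIcc_subset ha hb hc) hfc

namespace IsSolution

variable {g m₁ m₂ : ℕ} {ξ θ α : ℝ → ℝ}

/-- Starting above the critical value of `ξ`, an arc on which `ξ'` does not vanish and which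
returns to its initial angle is a descending arc. -/
lemma isDescendingArc (h : IsSolution g m₁ m₂ ξ θ α) (hm₁ : 0 < m₁) (hm₂ : 0 < m₂)
    (hα : α 0 = π / 2) (hθ : θ 0 ∈ Ioo 0 (π / 2))
    (hξ : 0 ≤ excess g m₁ m₂ (ξ 0)) {T : ℝ} (hT : 0 < T) (hθT : θ T = θ 0)
    (hne : ∀ t ∈ Ioo 0 T, cos (α t) * sin (2 * θ t) ≠ 0) :
    IsDescendingArc g m₁ m₂ ξ θ α T := by
  have hcont := h.continuous_theta
  have hmem : ∀ t ∈ Icc 0 T, θ t ∈ Ioo 0 (π / 2) := by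
    have hnot : ∀ t ∈ Icc 0 T, sin (2 * θ t) ≠ 0 := fun t ht => by
      rcases ht.1.eq_or_lt with rfl | h0
      · exact (sin_two_mul_pos hθ).ne'
      rcases ht.2.eq_or_lt with rfl | h1
      · exact hθT ▸ (sin_two_mul_pos hθ).ne'
      · exact right_ne_zero_of_mul (hne t ⟨h0, h1⟩)
    have h0 : (0 : ℝ) ∈ Icc 0 T := ⟨le_rfl, hT.le⟩
    intro t ht
    constructor
    · rcases hcont.pos_or_neg_of_ne_zero (ordConnected_Icc (a := 0) (b := T))
        (fun t ht h => hnot t ht (by simp [h])) with hp | hp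
      · exact hp t ht
      · exact absurd (hp 0 h0) (not_lt.2 hθ.1.le)
    · have hsub : Continuous fun t => θ t - π / 2 := by fun_prop
      rcases hsub.pos_or_neg_of_ne_zero (ordConnected_Icc (a := 0) (b := T))
        (fun t ht h => hnot t ht (by rw [sub_eq_zero.1 h, mul_div_cancel₀ _ two_ne_zero, sin_pi]))
        with hp | hp
      · linarith [hp 0 h0, hθ.2]
      · linarith [hp t ht]
  refine ⟨h, hT, hα, hmem, ?_⟩
  have hcos : Continuous fun t => cos (α t) := continuous_cos.comp h.continuous_alpha
  refine (hcos.pos_or_neg_of_ne_zero ordConnected_Ioo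
    fun t ht => left_ne_zero_of_mul (hne t ht)).resolve_left fun hp => ?_
  have hS : ∀ t ∈ Ioo 0 T, 0 < sin (2 * θ t) := fun t ht =>
    sin_two_mul_pos (hmem t (Ioo_subset_Icc_self ht))
  have hξmono : ∀ t ∈ Ioo 0 T, ξ 0 ≤ ξ t := fun t ht => by
    have := sub_le_sub_of_hasDerivAt_le (f := fun _ => (0 : ℝ)) ht.1.le
      (fun s _ => hasDerivAt_const s 0) (fun s _ => (h s).1)
      fun s hs => (mul_pos (hp s ⟨hs.1, hs.2.trans ht.2⟩) (hS s ⟨hs.1, hs.2.trans ht.2⟩)).le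
    linarith
  have hflux := sub_le_sub_of_hasDerivAt_le (f := fun _ => (0 : ℝ)) (a := 0) (b := T / 2) (by linarith)
    (fun s _ => hasDerivAt_const s 0) (fun s _ => h.hasDerivAt_flux hm₁ hm₂ s) fun s hs => by
      have hs' : s ∈ Ioo 0 T := ⟨hs.1, by linarith [hs.2]⟩
      have hW := angleWeight_pos (p := m₁) (r := m₂) (hmem s (Ioo_subset_Icc_self hs'))
      have := hS s hs'
      exact mul_nonneg (by positivity) (hξ.trans (excess_mono (hξmono s hs')))
  have hhalf : T / 2 ∈ Ioo 0 T := ⟨by linarith, by linarith⟩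
  have := mul_pos (angleWeight_pos (p := m₁) (r := m₂) (hmem _ (Ioo_subset_Icc_self hhalf)))
    (hp _ hhalf)
  simp only [flux, hα, cos_pi_div_two] at hflux
  linarith

end IsSolution

namespace IsDescendingArc

variable {g m₁ m₂ : ℕ} {ξ θ α : ℝ → ℝ} {T : ℝ}

lemma cos_nonpos (h : IsDescendingArc g m₁ m₂ ξ θ α T) {t : ℝ} (ht : t ∈ Icc 0 T) :
    cos (α t) ≤ 0 := by
  have hclosed : IsClosed {t | cos (α t) ≤ 0} :=
    isClosed_le (continuous_cos.comp h.sol.continuous_alpha) continuous_const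
  rw [← closure_Ioo h.pos.ne] at ht
  exact hclosed.closure_subset_iff.2 (fun s hs => (h.cos_neg s hs).le) ht

lemma xi_antitone (h : IsDescendingArc g m₁ m₂ ξ θ α T) {a b : ℝ} (ha : 0 ≤ a) (hab : a ≤ b)
    (hb : b ≤ T) : ξ b ≤ ξ a := by
  have := sub_le_sub_of_hasDerivAt_le (h := fun _ => (0 : ℝ)) hab
    (fun s _ => (h.sol s).1) (fun s _ => hasDerivAt_const s 0) fun s hs =>
      have hs' : s ∈ Ioo 0 T := ⟨ha.trans_lt hs.1, hs.2.trans_le hb⟩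
      (mul_neg_of_neg_of_pos (h.cos_neg s hs')
        (sin_two_mul_pos (h.theta_mem s (Ioo_subset_Icc_self hs')))).le
  linarith

/-- If the flux is at least `q` on `[a, b]`, then `ξ` drops at least by `q` times the drop of
`log cos θ`. -/
lemma mul_log_cos_drop_le (h : IsDescendingArc g m₁ m₂ ξ θ α T) (hm₂ : 0 < m₂) {a b q : ℝ}
    (ha : 0 ≤ a) (hab : a ≤ b) (hb : b ≤ T) (hq : 0 ≤ q)
    (hflux : ∀ t ∈ Ioo a b, q ≤ flux m₁ m₂ θ α t) :
    q * (log (cos (θ a)) - log (cos (θ b))) ≤ ξ a - ξ b := by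
  have hcos : ∀ t ∈ Icc a b, 0 < cos (θ t) := fun t ht =>
    have hθ := h.theta_mem t ⟨ha.trans ht.1, ht.2.trans hb⟩
    cos_pos_of_mem_Ioo ⟨by linarith [hθ.1, pi_pos], hθ.2⟩
  have := sub_le_sub_of_hasDerivAt_le hab (fun s _ => (h.sol s).1)
    (fun s hs => (((h.sol s).2.1.cos.log (hcos s hs).ne').const_mul q)) fun s hs => by
      have hs' : s ∈ Ioo 0 T := ⟨ha.trans_lt hs.1, hs.2.trans_le hb⟩
      have hθ := h.theta_mem s (Ioo_subset_Icc_self hs')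
      have hc := hcos s (Ioo_subset_Icc_self hs)
      have hsin := sin_pos_of_mem_Ioo (x := θ s) ⟨hθ.1, by linarith [hθ.2, pi_pos]⟩
      have hQ := hflux s hs
      have hW := angleWeight_le_cos (p := m₁) hm₂ hθ
      have hu := h.cos_neg s hs'
      have hqc : q ≤ -cos (α s) * cos (θ s) := by
        unfold flux at hQ
        nlinarith
      have hss : sin (α s) * sin (θ s) ≤ 1 := by
        nlinarith [sin_le_one (α s), sin_le_one (θ s)]
      have hrw : q * (-sin (θ s) * (sin (α s) * sin (2 * θ s)) / cos (θ s)) =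
          -(2 * q * sin (θ s) * (sin (α s) * sin (θ s))) := by
        rw [sin_two_mul]
        field_simp
      rw [hrw, sin_two_mul]
      have h1 : q * sin (θ s) ≤ -cos (α s) * cos (θ s) * sin (θ s) :=
        mul_le_mul_of_nonneg_right hqc hsin.le
      have h2 : q * sin (θ s) * (sin (α s) * sin (θ s)) ≤ q * sin (θ s) * 1 :=
        mul_le_mul_of_nonneg_left hss (by positivity)
      nlinarith
  linarith

end IsDescendingArc

namespace IsDescendingArc

variable {g m₁ m₂ : ℕ} {ξ θ α : ℝ → ℝ} {T : ℝ}

lemma flux_nonneg (h : IsDescendingArc g m₁ m₂ ξ θ α T) {t : ℝ} (ht : t ∈ Icc 0 T) :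
    0 ≤ flux m₁ m₂ θ α t :=
  neg_nonneg.2 (mul_nonpos_of_nonneg_of_nonpos
    (angleWeight_pos (h.theta_mem t ht)).le (h.cos_nonpos ht))

/-- An arc which returns to its initial angle has a first turning point, where it is
horizontal. -/
lemma exists_turning (h : IsDescendingArc g m₁ m₂ ξ θ α T) (hθ : θ T = θ 0) :
    ∃ t₁ ∈ Ioo 0 T, cos (α t₁) = -1 ∧ ∀ t ∈ Ico 0 t₁, 0 < sin (α t) := by
  have hcont : Continuous fun t => sin (α t) := continuous_sin.comp h.sol.continuous_alpha
  have hex : ∃ t ∈ Ioo 0 T, sin (α t) ≤ 0 := by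
    by_contra! hcon
    have hmono : StrictMonoOn θ (Icc 0 T) := by
      refine strictMonoOn_of_deriv_pos (convex_Icc 0 T) h.sol.continuous_theta.continuousOn
        fun t ht => ?_
      rw [interior_Icc] at ht
      rw [(h.sol t).2.1.deriv]
      exact mul_pos (hcon t ht) (sin_two_mul_pos (h.theta_mem t (Ioo_subset_Icc_self ht)))
    exact (hmono (left_mem_Icc.2 h.pos.le) (right_mem_Icc.2 h.pos.le) h.pos).ne' hθ
  obtain ⟨b, hb, hsb⟩ := hex
  obtain ⟨t₁, ht₁, hs, hpos⟩ := exists_first_hit hcont hb.1.le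
    (by simp [h.alpha_zero] : (0 : ℝ) < sin (α 0)) hsb
  have ht₁' : t₁ ∈ Ioo 0 T := ⟨ht₁.1, ht₁.2.trans_lt hb.2⟩
  refine ⟨t₁, ht₁', ?_, hpos⟩
  nlinarith [sin_sq_add_cos_sq (α t₁), h.cos_neg t₁ ht₁']

section FirstBranch

variable {t₁ : ℝ}

lemma theta_mono (h : IsDescendingArc g m₁ m₂ ξ θ α T) (ht₁ : t₁ ≤ T)
    (hpos : ∀ t ∈ Ico 0 t₁, 0 < sin (α t)) {a b : ℝ} (ha : 0 ≤ a) (hab : a ≤ b) (hb : b ≤ t₁) :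
    θ a ≤ θ b := by
  have := sub_le_sub_of_hasDerivAt_le (f := fun _ => (0 : ℝ)) hab
    (fun s _ => hasDerivAt_const s 0) (fun s _ => (h.sol s).2.1) fun s hs =>
      (mul_pos (hpos s ⟨ha.trans hs.1.le, hs.2.trans_le hb⟩) (sin_two_mul_pos
        (h.theta_mem s ⟨ha.trans hs.1.le, (hs.2.le.trans hb).trans ht₁⟩))).le
  linarith

lemma flux_le (h : IsDescendingArc g m₁ m₂ ξ θ α T) (hm₁ : 0 < m₁) (hm₂ : 0 < m₂)
    (ht₁ : t₁ ≤ T) (hpos : ∀ t ∈ Ico 0 t₁, 0 < sin (α t)) (hξ : 0 ≤ excess g m₁ m₂ (ξ 0))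
    {t : ℝ} (ht : t ∈ Icc 0 t₁) :
    flux m₁ m₂ θ α t ≤ excess g m₁ m₂ (ξ 0) * (π / 2) := by
  have key := sub_le_sub_of_hasDerivAt_le ht.1
    (fun s _ => h.sol.hasDerivAt_flux hm₁ hm₂ s)
    (fun s _ => (h.sol s).2.1.const_mul (excess g m₁ m₂ (ξ 0))) fun s hs => by
      have hs₁ : s < t₁ := hs.2.trans_le ht.2
      have hθ := h.theta_mem s ⟨hs.1.le, hs₁.le.trans ht₁⟩
      have hW := angleWeight_pos (p := m₁) (r := m₂) hθ
      have hW1 : angleWeight m₁ m₂ (θ s) ≤ 1 :=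
        (angleWeight_le_cos hm₂ hθ).trans (cos_le_one _)
      have hS := sin_two_mul_pos hθ
      have hs0 := hpos s ⟨hs.1.le, hs₁⟩
      have hE := excess_mono (g := g) (m₁ := m₁) (m₂ := m₂)
        (h.xi_antitone le_rfl hs.1.le (hs₁.le.trans ht₁))
      have hWs : angleWeight m₁ m₂ (θ s) * sin (α s) ≤ 1 :=
        mul_le_one₀ hW1 hs0.le (sin_le_one _)
      calc angleWeight m₁ m₂ (θ s) * sin (2 * θ s) * sin (α s) ^ 2 * excess g m₁ m₂ (ξ s)
          ≤ angleWeight m₁ m₂ (θ s) * sin (2 * θ s) * sin (α s) ^ 2 * excess g m₁ m₂ (ξ 0) :=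
            mul_le_mul_of_nonneg_left hE (by positivity)
        _ = angleWeight m₁ m₂ (θ s) * sin (α s) *
              (excess g m₁ m₂ (ξ 0) * (sin (α s) * sin (2 * θ s))) := by ring
        _ ≤ 1 * (excess g m₁ m₂ (ξ 0) * (sin (α s) * sin (2 * θ s))) :=
            mul_le_mul_of_nonneg_right hWs (by positivity)
        _ = _ := one_mul _
  have h0 : flux m₁ m₂ θ α 0 = 0 := by simp [flux, h.alpha_zero]
  have hθ0 := h.theta_mem 0 ⟨le_rfl, h.pos.le⟩
  have hθt := h.theta_mem t ⟨ht.1, ht.2.trans ht₁⟩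
  nlinarith [mul_nonneg hξ (by linarith [hθ0.1, hθt.2] : 0 ≤ π / 2 - (θ t - θ 0))]

end FirstBranch

lemma flux_le_flux_of_excess_nonneg (h : IsDescendingArc g m₁ m₂ ξ θ α T) (hm₁ : 0 < m₁)
    (hm₂ : 0 < m₂) {a b : ℝ} (ha : 0 ≤ a) (hab : a ≤ b) (hb : b ≤ T)
    (hE : ∀ s ∈ Ioo a b, 0 ≤ excess g m₁ m₂ (ξ s)) :
    flux m₁ m₂ θ α a ≤ flux m₁ m₂ θ α b := by
  have := sub_le_sub_of_hasDerivAt_le (f := fun _ => (0 : ℝ)) hab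
    (fun s _ => hasDerivAt_const s 0) (fun s _ => h.sol.hasDerivAt_flux hm₁ hm₂ s) fun s hs => by
      have hθ := h.theta_mem s ⟨ha.trans hs.1.le, hs.2.le.trans hb⟩
      have := angleWeight_pos (p := m₁) (r := m₂) hθ
      have := sin_two_mul_pos hθ
      exact mul_nonneg (by positivity) (hE s hs)
  linarith

lemma flux_le_flux_of_excess_nonpos (h : IsDescendingArc g m₁ m₂ ξ θ α T) (hm₁ : 0 < m₁)
    (hm₂ : 0 < m₂) {a b : ℝ} (ha : 0 ≤ a) (hab : a ≤ b) (hb : b ≤ T)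
    (hE : ∀ s ∈ Ioo a b, excess g m₁ m₂ (ξ s) ≤ 0) :
    flux m₁ m₂ θ α b ≤ flux m₁ m₂ θ α a := by
  have := sub_le_sub_of_hasDerivAt_le (h := fun _ => (0 : ℝ)) hab
    (fun s _ => h.sol.hasDerivAt_flux hm₁ hm₂ s) (fun s _ => hasDerivAt_const s 0) fun s hs => by
      have hθ := h.theta_mem s ⟨ha.trans hs.1.le, hs.2.le.trans hb⟩
      have := angleWeight_pos (p := m₁) (r := m₂) hθ
      have := sin_two_mul_pos hθ
      exact mul_nonpos_of_nonneg_of_nonpos (by positivity) (hE s hs)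
  linarith

lemma half_le_abs_sin (h : IsDescendingArc g m₁ m₂ ξ θ α T) {w t : ℝ} (ht : t ∈ Icc 0 T)
    (hw : 0 < w) (hwW : w ≤ angleWeight m₁ m₂ (θ t)) (hq : flux m₁ m₂ θ α t ≤ w / 2) :
    1 / 2 ≤ |sin (α t)| := by
  have hu := h.cos_nonpos ht
  have hcos : -(1 / 2) ≤ cos (α t) := by
    unfold flux at hq
    by_contra! hlt
    nlinarith
  refine abs_le_of_sq_le_sq' ?_ (abs_nonneg _) |>.2
  rw [sq_abs]
  nlinarith [sin_sq_add_cos_sq (α t)]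

/-- If `ξ` is within `ε` of its initial value `ξ₀` above the critical value, then along the first
part of the arc, where `W ≥ w`, the flux grows to a definite multiple of `ε`. -/
lemma le_flux_of_first_branch (h : IsDescendingArc g m₁ m₂ ξ θ α T) (hg : 0 < g) (hm₁ : 0 < m₁)
    (hm₂ : 0 < m₂) {ε w t : ℝ} (hε : 0 < ε) (hw : 0 < w)
    (hξ0 : ξ 0 = (g : ℝ) / 4 * log (mconst g m₁ m₂) + ε) (ht : t ∈ Icc 0 T)
    (hcrit : (g : ℝ) / 4 * log (mconst g m₁ m₂) ≤ ξ t)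
    (hsin : ∀ s ∈ Icc 0 t, 0 < sin (α s)) (hwW : ∀ s ∈ Icc 0 t, w ≤ angleWeight m₁ m₂ (θ s))
    (hq : ∀ s ∈ Icc 0 t, flux m₁ m₂ θ α s ≤ w / 2) (hθ : θ 0 < θ t) :
    min (w * mconst g m₁ m₂ * (4 / g) / 4 * (θ t - θ 0)) (w / (4 * (θ t - θ 0))) * ε ≤
      flux m₁ m₂ θ α t := by
  have hm := mconst_pos (g := g) (m₂ := m₂) hm₁
  have hk : (0 : ℝ) < 4 / g := div_pos four_pos (Nat.cast_pos.2 hg)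
  have hd : 0 < θ t - θ 0 := sub_pos.2 hθ
  have hhalf : ∀ s ∈ Icc 0 t, 1 / 2 ≤ sin (α s) := fun s hs => by
    have := h.half_le_abs_sin ⟨hs.1, hs.2.trans ht.2⟩ hw (hwW s hs) (hq s hs)
    rwa [abs_of_pos (hsin s hs)] at this
  have hS : ∀ s ∈ Icc 0 t, 0 < sin (2 * θ s) := fun s hs =>
    sin_two_mul_pos (h.theta_mem s ⟨hs.1, hs.2.trans ht.2⟩)
  have h0 : flux m₁ m₂ θ α 0 = 0 := by simp [flux, h.alpha_zero]
  have hEle : ∀ s ∈ Icc 0 t, excess g m₁ m₂ (ξ t) ≤ excess g m₁ m₂ (ξ s) := fun s hs =>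
    excess_mono (h.xi_antitone hs.1 hs.2 ht.2)
  set x := ξ t - (g : ℝ) / 4 * log (mconst g m₁ m₂) with hx
  have hxE : mconst g m₁ m₂ * (4 / g * x) ≤ excess g m₁ m₂ (ξ t) := by
    have hξt : ξ t = (g : ℝ) / 4 * log (mconst g m₁ m₂) + x := by rw [hx]; ring
    rw [hξt, excess_critical_add hg hm₁]
    exact mul_le_mul_of_nonneg_left (by linarith [add_one_le_exp (4 / (g : ℝ) * x)]) hm.le
  have hx0 : 0 ≤ x := sub_nonneg.2 hcrit
  have hEt : 0 ≤ excess g m₁ m₂ (ξ t) := le_trans (by positivity) hxE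
  rcases le_or_gt (ε / 2) x with hlarge | hsmall
  · have key := sub_le_sub_of_hasDerivAt_le ht.1
      (fun s _ => (h.sol s).2.1.const_mul (w / 2 * excess g m₁ m₂ (ξ t)))
      (fun s _ => h.sol.hasDerivAt_flux hm₁ hm₂ s) fun s hs => by
        have hs' := Ioo_subset_Icc_self hs
        have hs1 := hhalf s hs'
        have hs2 := hS s hs'
        have hWs : w / 2 ≤ angleWeight m₁ m₂ (θ s) * sin (α s) := by
          nlinarith [hwW s hs']
        calc w / 2 * excess g m₁ m₂ (ξ t) * (sin (α s) * sin (2 * θ s))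
            = w / 2 * (excess g m₁ m₂ (ξ t) * (sin (α s) * sin (2 * θ s))) := by ring
          _ ≤ angleWeight m₁ m₂ (θ s) * sin (α s) *
                (excess g m₁ m₂ (ξ s) * (sin (α s) * sin (2 * θ s))) :=
              mul_le_mul hWs (mul_le_mul_of_nonneg_right (hEle s hs') (by positivity))
                (by positivity) (by linarith)
          _ = _ := by ring
    calc _ ≤ w * mconst g m₁ m₂ * (4 / g) / 4 * (θ t - θ 0) * ε :=
          mul_le_mul_of_nonneg_right (min_le_left _ _) hε.le
      _ = w / 2 * (mconst g m₁ m₂ * (4 / g * (ε / 2))) * (θ t - θ 0) := by ring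
      _ ≤ w / 2 * excess g m₁ m₂ (ξ t) * (θ t - θ 0) := by
          gcongr
          exact le_trans (by gcongr) hxE
      _ ≤ flux m₁ m₂ θ α t := by linarith
  · have hmono : ∀ s ∈ Icc 0 t, flux m₁ m₂ θ α s ≤ flux m₁ m₂ θ α t := fun s hs => by
      refine h.flux_le_flux_of_excess_nonneg hm₁ hm₂ hs.1 hs.2 ht.2 fun r hr => ?_
      exact hEt.trans (hEle r ⟨hs.1.trans hr.1.le, hr.2.le⟩)
    have hQ : 0 ≤ flux m₁ m₂ θ α t := h.flux_nonneg ht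
    have key := sub_le_sub_of_hasDerivAt_le ht.1
      (fun s _ => (h.sol s).1.neg)
      (fun s _ => (h.sol s).2.1.const_mul (2 * flux m₁ m₂ θ α t / w)) fun s hs => by
        have hs' := Ioo_subset_Icc_self hs
        have hs1 := hhalf s hs'
        have hs2 := hS s hs'
        have hu : -cos (α s) ≤ flux m₁ m₂ θ α t / w := by
          rw [le_div_iff₀ hw]
          have hc := h.cos_nonpos ⟨hs'.1, hs'.2.trans ht.2⟩
          have := hmono s hs'
          rw [flux] at this
          nlinarith [hwW s hs']
        calc -(cos (α s) * sin (2 * θ s)) = -cos (α s) * sin (2 * θ s) := by ring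
          _ ≤ flux m₁ m₂ θ α t / w * sin (2 * θ s) := mul_le_mul_of_nonneg_right hu hs2.le
          _ = flux m₁ m₂ θ α t / w * (2 * (1 / 2) * sin (2 * θ s)) := by ring
          _ ≤ flux m₁ m₂ θ α t / w * (2 * sin (α s) * sin (2 * θ s)) := by gcongr
          _ = _ := by ring
    have hdrop : ε / 2 ≤ 2 * flux m₁ m₂ θ α t / w * (θ t - θ 0) := by
      simp only [Pi.neg_apply] at key
      linarith
    calc _ ≤ w / (4 * (θ t - θ 0)) * ε :=
          mul_le_mul_of_nonneg_right (min_le_right _ _) hε.le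
      _ = w / (2 * (θ t - θ 0)) * (ε / 2) := by field_simp; ring
      _ ≤ w / (2 * (θ t - θ 0)) * (2 * flux m₁ m₂ θ α t / w * (θ t - θ 0)) := by gcongr
      _ = flux m₁ m₂ θ α t := by field_simp

/-- Below the critical value of `ξ`, a descent of `θ` through a region where `W ≥ w` costs a
definite amount of flux. -/
lemma mul_le_flux_of_passage (h : IsDescendingArc g m₁ m₂ ξ θ α T) (hm₁ : 0 < m₁)
    (hm₂ : 0 < m₂) {w a b c : ℝ} (ha : 0 ≤ a) (hab : a ≤ b) (hb : b ≤ T) (hw : 0 < w)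
    (hwW : ∀ s ∈ Icc a b, w ≤ angleWeight m₁ m₂ (θ s))
    (hq : ∀ s ∈ Ioo a b, flux m₁ m₂ θ α s ≤ w / 2) (hc : 0 ≤ c)
    (hE : ∀ s ∈ Ioo a b, excess g m₁ m₂ (ξ s) ≤ -c) :
    c * (w / 2) * (θ a - θ b) ≤ flux m₁ m₂ θ α a - flux m₁ m₂ θ α b := by
  have key := sub_le_sub_of_hasDerivAt_le hab
    (fun s _ => h.sol.hasDerivAt_flux hm₁ hm₂ s)
    (fun s _ => (h.sol s).2.1.const_mul (c * (w / 2))) fun s hs => by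
      have hs' : s ∈ Icc 0 T := ⟨ha.trans hs.1.le, hs.2.le.trans hb⟩
      have hW := hwW s (Ioo_subset_Icc_self hs)
      have hS := sin_two_mul_pos (h.theta_mem s hs')
      have hhalf := h.half_le_abs_sin hs' hw hW (hq s hs)
      have hWs : w / 2 ≤ angleWeight m₁ m₂ (θ s) * |sin (α s)| := by nlinarith
      have hWpos := hw.trans_le hW
      have hmain : w / 2 * (|sin (α s)| * sin (2 * θ s)) * c ≤
          angleWeight m₁ m₂ (θ s) * sin (2 * θ s) * sin (α s) ^ 2 * -excess g m₁ m₂ (ξ s) :=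
        calc w / 2 * (|sin (α s)| * sin (2 * θ s)) * c
            ≤ angleWeight m₁ m₂ (θ s) * |sin (α s)| * (|sin (α s)| * sin (2 * θ s)) *
                -excess g m₁ m₂ (ξ s) := by
              refine mul_le_mul (mul_le_mul_of_nonneg_right hWs (by positivity))
                (by linarith [hE s hs]) hc (by positivity)
          _ = angleWeight m₁ m₂ (θ s) * sin (2 * θ s) * |sin (α s)| ^ 2 *
                -excess g m₁ m₂ (ξ s) := by ring
          _ = _ := by rw [sq_abs]
      have habs : -(|sin (α s)| * sin (2 * θ s)) ≤ sin (α s) * sin (2 * θ s) := by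
        nlinarith [neg_abs_le (sin (α s))]
      have := mul_le_mul_of_nonneg_left habs (by positivity : 0 ≤ c * (w / 2))
      linarith
  linarith

end IsDescendingArc

lemma le_of_one_sub_exp_neg_le {y η : ℝ} (hη : η ≤ 1 / 2) (hy : 0 ≤ y)
    (h : 1 - exp (-y) ≤ η) : y ≤ 2 * η := by
  have h1 : exp (-y) * (1 + y) ≤ 1 := by
    calc exp (-y) * (1 + y) ≤ exp (-y) * exp y := by
          gcongr
          linarith [add_one_le_exp y]
      _ = 1 := by rw [← exp_add, neg_add_cancel, exp_zero]
  nlinarith [mul_nonneg hy (sub_nonneg.2 hη)]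

/-- No descending arc which starts close enough above the critical value of `ξ` returns to its
initial angle. -/
lemma exists_forall_not_returning {g m₁ m₂ : ℕ} (hg : 0 < g) (hm₁ : 0 < m₁) (hm₂ : 0 < m₂)
    {φ : ℝ} (hφ : φ ∈ Ioo 0 (π / 2)) :
    ∃ δ > 0, ∀ (ξ θ α : ℝ → ℝ) (T ε : ℝ), IsDescendingArc g m₁ m₂ ξ θ α T → θ 0 = φ → θ T = φ →
      0 < ε → ξ 0 = (g : ℝ) / 4 * log (mconst g m₁ m₂) + ε →
      ¬ excess g m₁ m₂ (ξ 0) * (π / 2) < δ := by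
  have hm := mconst_pos (g := g) (m₂ := m₂) hm₁
  have hk : (0 : ℝ) < 4 / g := div_pos four_pos (Nat.cast_pos.2 hg)
  obtain ⟨φa, hφφa, hφa⟩ : ∃ φa, φ < φa ∧ φa < π / 2 := exists_between hφ.2
  have hd : 0 < φa - φ := sub_pos.2 hφφa
  have hsinφ : 0 < sin φ := sin_pos_of_mem_Ioo ⟨hφ.1, by linarith [hφ.2, pi_pos]⟩
  have hw : 0 < sin φ ^ m₁ * cos φa ^ m₂ :=
    mul_pos (pow_pos hsinφ _)
      (pow_pos (cos_pos_of_mem_Ioo ⟨by linarith [hφ.1, pi_pos], hφa⟩) _)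
  set w := sin φ ^ m₁ * cos φa ^ m₂
  -- the rate at which the flux at the angle `φa` grows with `ε`
  set c := min (w * mconst g m₁ m₂ * (4 / g) / 4 * (φa - φ)) (w / (4 * (φa - φ))) with hc
  have hc0 : 0 < c := lt_min (by positivity) (by positivity)
  obtain ⟨φ₀, hφ₀, hK₀⟩ := exists_log_cos_drop ⟨hφ.1.trans hφφa, hφa⟩ (inv_pos.2 hc0)
  -- the rate at which the second branch consumes flux
  set c' := w / 2 * (φa - φ) with hc'
  have hc'0 : 0 < c' := by positivity
  have hKpos : 0 < 2 / (c' * mconst g m₁ m₂ * (4 / g)) + 1 := by positivity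
  obtain ⟨φ₁, hφ₁, hK₁⟩ := exists_log_cos_drop
    ⟨hφ.1.trans (hφφa.trans hφ₀.1), hφ₀.2⟩ hKpos
  have hw₁ : 0 < sin φ ^ m₁ * cos φ₁ ^ m₂ :=
    mul_pos (pow_pos hsinφ _) (pow_pos (cos_pos_of_mem_Ioo
      ⟨by linarith [hφ.1, pi_pos, hφ₁.1, hφ₀.1], hφ₁.2⟩) _)
  refine ⟨min (w / 2) (min (sin φ ^ m₁ * cos φ₁ ^ m₂) (c' * mconst g m₁ m₂ / 2)),
    by positivity, fun ξ θ α T ε h hθ0 hθT hε hξ0 hδ => ?_⟩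
  obtain ⟨hδw, hδ'⟩ := lt_min_iff.1 hδ
  obtain ⟨hδ₁, hδc⟩ := lt_min_iff.1 hδ'
  obtain ⟨t₁, ht₁, hcos, hpos⟩ := h.exists_turning (hθT.trans hθ0.symm)
  have ht₁T := ht₁.2.le
  have hξ0' : 0 ≤ excess g m₁ m₂ (ξ 0) := excess_nonneg hg hm₁ (by linarith)
  have hfluxle : ∀ t ∈ Icc 0 t₁, flux m₁ m₂ θ α t ≤ excess g m₁ m₂ (ξ 0) * (π / 2) :=
    fun t ht => h.flux_le hm₁ hm₂ ht₁T hpos hξ0' ht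
  have hq : flux m₁ m₂ θ α t₁ = angleWeight m₁ m₂ (θ t₁) := by simp [flux, hcos]
  have hq0 : 0 < flux m₁ m₂ θ α t₁ :=
    hq ▸ angleWeight_pos (h.theta_mem t₁ (Ioo_subset_Icc_self ht₁))
  have hqle := hfluxle t₁ (right_mem_Icc.2 ht₁.1.le)
  have hφθ₁ : φ ≤ θ t₁ := hθ0 ▸ h.theta_mono ht₁T hpos le_rfl ht₁.1.le le_rfl
  have hθ₁ : φ₁ < θ t₁ := by
    by_contra! hle
    have := le_angleWeight (p := m₁) (r := m₂) hφ.1 hφ₁.2 ⟨hφθ₁, hle⟩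
    linarith
  obtain ⟨t₀, ht₀, hθ₀⟩ := intermediate_value_Icc ht₁.1.le h.sol.continuous_theta.continuousOn
    (⟨by linarith [hφ₀.1], by linarith [hφ₁.1]⟩ : φ₀ ∈ Icc (θ 0) (θ t₁))
  obtain ⟨ta, hta, hθa⟩ := intermediate_value_Icc ht₀.1 h.sol.continuous_theta.continuousOn
    (⟨by linarith, by linarith [hφ₀.1]⟩ : φa ∈ Icc (θ 0) (θ t₀))
  have hξt₀ : ξ t₀ ≤ (g : ℝ) / 4 * log (mconst g m₁ m₂) := by
    by_contra! hgt
    have ht₀T : t₀ ≤ T := ht₀.2.trans ht₁T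
    have hta₁ : ta < t₁ := lt_of_le_of_ne (hta.2.trans ht₀.2) fun he => by
      rw [he] at hθa
      linarith [hφ₀.1, hφ₁.1]
    have hQ := h.le_flux_of_first_branch hg hm₁ hm₂ (w := w) (t := ta) hε hw hξ0
      ⟨hta.1, (hta₁.trans ht₁.2).le⟩ (hgt.le.trans (h.xi_antitone hta.1 hta.2 ht₀T))
      (fun s hs => hpos s ⟨hs.1, hs.2.trans_lt hta₁⟩)
      (fun s hs => le_angleWeight hφ.1 hφa
        ⟨hθ0 ▸ h.theta_mono ht₁T hpos le_rfl hs.1 (hs.2.trans hta₁.le),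
          hθa ▸ h.theta_mono ht₁T hpos hs.1 hs.2 hta₁.le⟩)
      (fun s hs => (hfluxle s ⟨hs.1, hs.2.trans hta₁.le⟩).trans hδw.le) (by linarith)
    rw [hθa, hθ0, ← hc] at hQ
    have hdrop := h.mul_log_cos_drop_le hm₂ (q := c * ε) hta.1 hta.2 ht₀T (by positivity)
      fun t ht => hQ.trans (h.flux_le_flux_of_excess_nonneg hm₁ hm₂ hta.1 ht.1.le
        (ht.2.le.trans ht₀T) fun s hs => excess_nonneg hg hm₁ (hgt.le.trans
          (h.xi_antitone (hta.1.trans hs.1.le) (hs.2.trans ht.2).le ht₀T)))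
    rw [hθa, hθ₀] at hdrop
    have h1 : c * ε * c⁻¹ ≤ c * ε * (log (cos φa) - log (cos φ₀)) :=
      mul_le_mul_of_nonneg_left hK₀ (by positivity)
    rw [mul_comm c ε, mul_assoc, mul_inv_cancel₀ hc0.ne', mul_one] at h1
    have := h.xi_antitone le_rfl hta.1 (hta₁.le.trans ht₁T)
    linarith
  have hneg : ∀ s, t₀ ≤ s → s ≤ T → excess g m₁ m₂ (ξ s) ≤ 0 := fun s hs hsT =>
    excess_nonpos hg hm₁ ((h.xi_antitone ht₀.1 hs hsT).trans hξt₀)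
  have hdrop := h.mul_log_cos_drop_le hm₂ ht₀.1 ht₀.2 ht₁T hq0.le fun t ht =>
    h.flux_le_flux_of_excess_nonpos hm₁ hm₂ (ht₀.1.trans ht.1.le) ht.2.le ht₁T fun s hs =>
      hneg s (ht.1.le.trans hs.1.le) (hs.2.le.trans ht₁T)
  rw [hθ₀] at hdrop
  have hlog : log (cos (θ t₁)) ≤ log (cos φ₁) := by
    have hmem := h.theta_mem t₁ (Ioo_subset_Icc_self ht₁)
    exact log_le_log (cos_pos_of_mem_Ioo ⟨by linarith [hmem.1, pi_pos], hmem.2⟩)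
      (cos_le_cos_of_nonneg_of_le_pi (by linarith [hφ.1, hφ₀.1, hφ₁.1])
        (by linarith [hmem.2, pi_pos]) hθ₁.le)
  set X := (g : ℝ) / 4 * log (mconst g m₁ m₂) - ξ t₁ with hX
  have hXlow : flux m₁ m₂ θ α t₁ * (2 / (c' * mconst g m₁ m₂ * (4 / g)) + 1) ≤ X := by
    refine le_trans (mul_le_mul_of_nonneg_left ?_ hq0.le) (hdrop.trans (by linarith))
    linarith
  have hX0 : 0 < X := (mul_pos hq0 hKpos).trans_le hXlow
  have hEX : excess g m₁ m₂ (ξ t₁) = -(mconst g m₁ m₂ * (1 - exp (-(4 / g * X)))) := by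
    have : ξ t₁ = (g : ℝ) / 4 * log (mconst g m₁ m₂) + -X := by rw [hX]; ring
    rw [this, excess_critical_add hg hm₁, mul_neg]
    ring
  obtain ⟨a, b, ha, hab, hb, hθa', hθb, hpass⟩ := exists_descending_passage
    h.sol.continuous_theta ht₁T hφφa (by linarith [hφ₀.1, hφ₁.1] : φa ≤ θ t₁) hθT.le
  have hfluxq : ∀ s, t₁ ≤ s → s ≤ T → flux m₁ m₂ θ α s ≤ flux m₁ m₂ θ α t₁ := fun s hs hsT =>
    h.flux_le_flux_of_excess_nonpos hm₁ hm₂ ht₁.1.le hs hsT fun r hr =>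
      hneg r (ht₀.2.trans hr.1.le) (hr.2.le.trans hsT)
  have hcost := h.mul_le_flux_of_passage hm₁ hm₂ (c := -excess g m₁ m₂ (ξ t₁))
    (ht₁.1.le.trans ha) hab hb hw (fun s hs => le_angleWeight hφ.1 hφa (hpass s hs))
    (fun s hs => (hfluxq s (ha.trans hs.1.le) (hs.2.le.trans hb)).trans (hqle.trans hδw.le))
    (neg_nonneg.2 (hneg t₁ ht₀.2 ht₁T))
    (fun s hs => by
      rw [neg_neg]
      exact excess_mono (h.xi_antitone ht₁.1.le (ha.trans hs.1.le) (hs.2.le.trans hb)))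
  have hfb := h.flux_nonneg ⟨(ht₁.1.le.trans ha).trans hab, hb⟩
  have hfa := hfluxq a ha (hab.trans hb)
  rw [hθa', hθb, hEX, neg_neg] at hcost
  have hη : 1 - exp (-(4 / g * X)) ≤ flux m₁ m₂ θ α t₁ / (c' * mconst g m₁ m₂) := by
    rw [le_div_iff₀ (by positivity), hc']
    linarith
  have hη2 : flux m₁ m₂ θ α t₁ / (c' * mconst g m₁ m₂) ≤ 1 / 2 := by
    rw [div_le_iff₀ (by positivity)]
    linarith
  have hXup := le_of_one_sub_exp_neg_le hη2 (by positivity) hη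
  have hXup' : X ≤ flux m₁ m₂ θ α t₁ * (2 / (c' * mconst g m₁ m₂ * (4 / g))) := by
    calc X = 4 / g * X / (4 / g) := by field_simp
      _ ≤ 2 * (flux m₁ m₂ θ α t₁ / (c' * mconst g m₁ m₂)) / (4 / g) := by gcongr
      _ = _ := by field_simp
  linarith

lemma thetaStar_mem {m₁ m₂ : ℕ} (hm₁ : 0 < m₁) (hm₂ : 0 < m₂) :
    thetaStar m₁ m₂ ∈ Ioo 0 (π / 2) := by
  have h₁ : (0 : ℝ) < m₁ := Nat.cast_pos.2 hm₁
  have h₂ : (0 : ℝ) < m₂ := Nat.cast_pos.2 hm₂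
  exact ⟨arctan_pos.2 (sqrt_pos.2 (div_pos h₁ h₂)), arctan_lt_pi_div_two _⟩

lemma exists_excess_mul_lt {g m₁ m₂ : ℕ} (hg : 0 < g) (hm₁ : 0 < m₁) {δ : ℝ} (hδ : 0 < δ) :
    ∃ ε₀ > 0, ∀ ε, 0 < ε → ε < ε₀ →
      excess g m₁ m₂ ((g : ℝ) / 4 * log (mconst g m₁ m₂) + ε) * (π / 2) < δ := by
  have hcont : Continuous fun ε : ℝ =>
      excess g m₁ m₂ ((g : ℝ) / 4 * log (mconst g m₁ m₂) + ε) * (π / 2) := by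
    unfold excess
    fun_prop
  have h0 : excess g m₁ m₂ ((g : ℝ) / 4 * log (mconst g m₁ m₂) + 0) * (π / 2) < δ := by
    rw [excess_critical_add hg hm₁]
    simpa using hδ
  obtain ⟨ε₀, hε₀, hball⟩ := Metric.eventually_nhds_iff.1
    (hcont.continuousAt.eventually_lt continuousAt_const h0)
  exact ⟨ε₀, hε₀, fun ε h1 h2 => hball (by rwa [dist_zero_right, norm_eq_abs, abs_of_pos h1])⟩

/-- Proposition 3.2 (ii): for all sufficiently small `ε > 0` the initial value
`(g/4) ln m + ε` is not of type 1; consequently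
`ξ₀* = inf { r : every ξ₀ > r is of type 1 } > (g/4) ln m`. -/
theorem stmt10 (g m₁ m₂ : ℕ) (hg : g = 1 ∨ g = 2 ∨ g = 3 ∨ g = 4 ∨ g = 6)
    (hm₁ : 0 < m₁) (hm₂ : 0 < m₂)
    (Ξ Θ A : ℝ → ℝ → ℝ) (hfam : IsShootingFamily g m₁ m₂ Ξ Θ A) :
    ∃ ε₀ > (0 : ℝ),
      (∀ ε : ℝ, 0 < ε → ε < ε₀ →
        ¬ Type1 m₁ m₂ Ξ Θ A ((g : ℝ) / 4 * Real.log (mconst g m₁ m₂) + ε)) ∧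
      ({r : ℝ | ∀ ξ₀ > r, Type1 m₁ m₂ Ξ Θ A ξ₀}.Nonempty →
        sInf {r : ℝ | ∀ ξ₀ > r, Type1 m₁ m₂ Ξ Θ A ξ₀} >
          (g : ℝ) / 4 * Real.log (mconst g m₁ m₂)) := by
  have hg0 : 0 < g := by omega
  have hθ := thetaStar_mem hm₁ hm₂
  obtain ⟨δ, hδ, hnot⟩ := exists_forall_not_returning hg0 hm₁ hm₂ hθ
  obtain ⟨ε₀, hε₀, hsmall⟩ := exists_excess_mul_lt (m₂ := m₂) hg0 hm₁ hδ
  have hmain : ∀ ε : ℝ, 0 < ε → ε < ε₀ →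
      ¬ Type1 m₁ m₂ Ξ Θ A ((g : ℝ) / 4 * log (mconst g m₁ m₂) + ε) := by
    rintro ε hε hεε₀ ⟨T, hT, hΘT, hne⟩
    obtain ⟨hsol, hΞ0, hΘ0, hA0⟩ := hfam ((g : ℝ) / 4 * log (mconst g m₁ m₂) + ε)
    have harc := hsol.isDescendingArc hm₁ hm₂ hA0 (hΘ0 ▸ hθ)
      (excess_nonneg hg0 hm₁ (by rw [hΞ0]; linarith)) hT (hΘT.trans hΘ0.symm) hne
    exact hnot _ _ _ T ε harc hΘ0 hΘT hε hΞ0 (by rw [hΞ0]; exact hsmall ε hε hεε₀)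
  refine ⟨ε₀, hε₀, hmain, fun hS => ?_⟩
  refine lt_of_lt_of_le (lt_add_of_pos_right _ (half_pos hε₀)) (le_csInf hS fun r hr => ?_)
  by_contra! hlt
  exact hmain _ (half_pos hε₀) (half_lt_self hε₀) (hr _ hlt)
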